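/- Define the group Γ_{α,β} := { (a b; c d) ∈ SL₂(ℤ) : (a−1)α + cβ ∈ ℤ, bα + (d−1)β ∈ ℤ, m(cβ² − bα² + (d−a)αβ) ∈ ℤ } for fixed α, β ∈ ℚ and m ∈ ℕ. Then Γ_{α,β} is a subgroup of SL₂(ℤ) of finite index. -/

import Mathlib

noncomputable section

/-- Entry `(i,j)` of `γ ∈ SL₂(ℤ)` as a rational number. -/
def ent (γ : Matrix.SpecialLinearGroup (Fin 2) ℤ) (i j : Fin 2) : ℚ :=
  ((γ : Matrix (Fin 2) (Fin 2) ℤ) i j : ℚ)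

/-- Key divisibility for the third condition (up to a factor `q`). -/
lemma key_aux (p q m N A b c D A' b' c' D' x y w x' y' w' : ℤ) (hN : N ≠ 0)
    (h1 : p * A + q * c = N * x) (h2 : p * b + q * D = N * y)
    (hd : A + D + A * D - b * c = 0)
    (h3 : m * (c * q ^ 2 - b * p ^ 2 + (D - A) * p * q) = N ^ 2 * w)
    (h1' : p * A' + q * c' = N * x') (h2' : p * b' + q * D' = N * y')
    (hd' : A' + D' + A' * D' - b' * c' = 0)
    (h3' : m * (c' * q ^ 2 - b' * p ^ 2 + (D' - A') * p * q) = N ^ 2 * w') :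
    N ^ 2 ∣ q * (m * ((q * c - p * A) * (q * A' + p * b')
      + (q * D - p * b) * (q * c' + p * D'))) := by
  obtain ⟨z, hz⟩ : ∃ z, z = x * b - y * (1 + A) := ⟨_, rfl⟩
  obtain ⟨z', hz'⟩ : ∃ z', z' = x' * b' - y' * (1 + A') := ⟨_, rfl⟩
  have hA : q * A = p * b + N * z := by
    rw [hz]; linear_combination q * hd + b * h1 - (1 + A) * h2
  have hA' : q * A' = p * b' + N * z' := by
    rw [hz']; linear_combination q * hd' + b' * h1' - (1 + A') * h2'
  obtain ⟨h, hh⟩ : ∃ h, h = q * x + p * y - 2 * p * z := ⟨_, rfl⟩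
  obtain ⟨h', hh'⟩ : ∃ h, h = q * x' + p * y' - 2 * p * z' := ⟨_, rfl⟩
  have he : m * (-4 * b * p ^ 2 + N * h) = N ^ 2 * w := by
    rw [← h3, hh]; linear_combination (-m * q) * h1 + (-m * p) * h2 + (2 * m * p) * hA
  have he' : m * (-4 * b' * p ^ 2 + N * h') = N ^ 2 * w' := by
    rw [← h3', hh']; linear_combination (-m * q) * h1' + (-m * p) * h2' + (2 * m * p) * hA'
  obtain ⟨g, hg⟩ : ∃ g, g = m * h - N * w := ⟨_, rfl⟩
  obtain ⟨g', hg'⟩ : ∃ g, g = m * h' - N * w' := ⟨_, rfl⟩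
  have hgN : 4 * m * b * p ^ 2 = N * g := by rw [hg]; linear_combination -he
  have hgN' : 4 * m * b' * p ^ 2 = N * g' := by rw [hg']; linear_combination -he'
  have hgg : b' * g - b * g' = 0 := by
    have : N * (b' * g - b * g') = 0 := by linear_combination b * hgN' - b' * hgN
    exact (mul_eq_zero.mp this).resolve_left hN
  have hc : q * c - p * A = N * x - 2 * p * A := by linear_combination h1
  have hD : q * D - p * b = N * y - 2 * p * b := by linear_combination h2
  have hs : q * (q * c' + p * D') = -2 * p ^ 2 * b' + N * (q * x' + p * y' - p * z') := by
    linear_combination q * h1' + p * h2' - p * hA'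
  have hmain : q * ((q * c - p * A) * (q * A' + p * b')
      + (q * D - p * b) * (q * c' + p * D'))
      = (N * q * x - 2 * p ^ 2 * b - 2 * p * N * z) * (2 * p * b' + N * z')
        + (N * y - 2 * p * b) * (-2 * p ^ 2 * b' + N * (q * x' + p * y' - p * z')) := by
    have e1 : q * A' + p * b' = 2 * p * b' + N * z' := by linear_combination hA'
    rw [hc, hD, e1, ← hs]
    linear_combination (-2 * p * (2 * p * b' + N * z')) * hA
  have hG : m * (2 * p * (b' * (h - 2 * p * y) - b * (h' + 2 * p * z')))
      = N * (2 * p * (b' * w - b * w') - g' * y - g * z') := by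
    linear_combination (-2 * p * b') * hg + (2 * p * b) * hg' + 2 * p * hgg - y * hgN' - z' * hgN
  refine ⟨(2 * p * (b' * w - b * w') - g' * y - g * z')
    + m * ((q * x - 2 * p * z) * z' + y * (q * x' + p * y' - p * z')), ?_⟩
  have : q * (m * ((q * c - p * A) * (q * A' + p * b')
      + (q * D - p * b) * (q * c' + p * D'))) = m * (q * ((q * c - p * A) * (q * A' + p * b')
      + (q * D - p * b) * (q * c' + p * D'))) := by ring
  rw [this, hmain]
  subst hh hh'
  linear_combination N * hG

/-- Integral form of the three conditions. -/
def Cond (p q m N a b c d : ℤ) : Prop :=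
  N ∣ p * (a - 1) + q * c ∧ N ∣ p * b + q * (d - 1) ∧
    N ^ 2 ∣ m * (c * q ^ 2 - b * p ^ 2 + (d - a) * p * q)

lemma cond_mul (p q m N a b c d a' b' c' d' : ℤ) (hN : N ≠ 0) (hpq : IsCoprime p q)
    (hd : a * d - b * c = 1) (hd' : a' * d' - b' * c' = 1)
    (h : Cond p q m N a b c d) (h' : Cond p q m N a' b' c' d') :
    Cond p q m N (a * a' + b * c') (a * b' + b * d') (c * a' + d * c') (c * b' + d * d') := by
  obtain ⟨⟨x, h1⟩, ⟨y, h2⟩, ⟨w, h3⟩⟩ := h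
  obtain ⟨⟨x', h1'⟩, ⟨y', h2'⟩, ⟨w', h3'⟩⟩ := h'
  refine ⟨⟨x * a' + y * c' + x', ?_⟩, ⟨x * b' + y * d' + y', ?_⟩, ?_⟩
  · linear_combination a' * h1 + c' * h2 + h1'
  · linear_combination b' * h1 + d' * h2 + h2'
  · have k1 := key_aux p q m N (a - 1) b c (d - 1) (a' - 1) b' c' (d' - 1) x y w x' y' w' hN
      h1 h2 (by linear_combination hd) (by linear_combination h3)
      h1' h2' (by linear_combination hd') (by linear_combination h3')
    have k2 := key_aux q p m N (d - 1) c b (a - 1) (d' - 1) c' b' (a' - 1) y x (-w) y' x' (-w') hN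
      (by linear_combination h2) (by linear_combination h1) (by linear_combination hd)
      (by linear_combination -h3)
      (by linear_combination h2') (by linear_combination h1') (by linear_combination hd')
      (by linear_combination -h3')
    obtain ⟨s, t, hst⟩ := hpq
    obtain ⟨u, hu⟩ := k1
    obtain ⟨v, hv⟩ := k2
    refine ⟨w + w' + t * u - s * v, ?_⟩
    have hst' := hst
    linear_combination h3 + h3' + t * hu - s * hv - (m * ((q * c - p * (a - 1)) * (q * (a' - 1) + p * b')
      + (q * (d - 1) - p * b) * (q * c' + p * (d' - 1)))) * hst

lemma cond_inv (p q m N a b c d : ℤ) (hd : a * d - b * c = 1)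
    (h : Cond p q m N a b c d) : Cond p q m N d (-b) (-c) a := by
  obtain ⟨⟨x, h1⟩, ⟨y, h2⟩, ⟨w, h3⟩⟩ := h
  refine ⟨⟨c * y - d * x, ?_⟩, ⟨b * x - a * y, ?_⟩, ⟨-w, ?_⟩⟩
  · linear_combination c * h2 - d * h1 + p * hd
  · linear_combination b * h1 - a * h2 + q * hd
  · linear_combination -h3

lemma exists_repr (α β : ℚ) : ∃ (p q : ℤ) (δ : ℚ), IsCoprime p q ∧ α = δ * p ∧ β = δ * q := by
  have hα := Rat.num_div_den α
  have hβ := Rat.num_div_den β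
  have ha : (α.den : ℚ) ≠ 0 := by exact_mod_cast α.den_nz
  have hb : (β.den : ℚ) ≠ 0 := by exact_mod_cast β.den_nz
  by_cases h0 : α = 0 ∧ β = 0
  · exact ⟨1, 0, 0, isCoprime_one_left, by simp [h0.1], by simp [h0.2]⟩
  · have hP : Int.gcd (α.num * β.den) (β.num * α.den) ≠ 0 := by
      intro h
      rw [Int.gcd_eq_zero_iff] at h
      apply h0
      simpa using h
    obtain ⟨p, q, hpq, e1, e2⟩ := Int.exists_gcd_one (Nat.pos_of_ne_zero hP)
    set G := Int.gcd (α.num * β.den) (β.num * α.den)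
    refine ⟨p, q, G / (α.den * β.den), Int.isCoprime_iff_gcd_eq_one.mpr hpq, ?_, ?_⟩
    · have e1' : (α.num : ℚ) * β.den = p * G := by exact_mod_cast e1
      nth_rewrite 1 [← hα]
      field_simp
      linear_combination e1'
    · have e2' : (β.num : ℚ) * α.den = q * G := by exact_mod_cast e2
      nth_rewrite 1 [← hβ]
      field_simp
      linear_combination e2'

lemma range_iff (g N n : ℤ) (hN : N ≠ 0) (hg : IsCoprime N g) :
    ((g : ℚ) / N * n ∈ Set.range ((↑) : ℤ → ℚ)) ↔ N ∣ n := by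
  have hN' : (N : ℚ) ≠ 0 := by exact_mod_cast hN
  constructor
  · rintro ⟨k, hk⟩
    refine hg.dvd_of_dvd_mul_left ⟨k, ?_⟩
    field_simp at hk
    have : (N : ℚ) * k = g * n := by linear_combination hk
    exact_mod_cast this.symm
  · rintro ⟨k, rfl⟩
    refine ⟨g * k, ?_⟩
    push_cast
    field_simp

/-- `Γ_{α,β} = {(a b; c d) ∈ SL₂(ℤ) : (a−1)α+cβ, bα+(d−1)β, m(cβ²−bα²+(d−a)αβ) ∈ ℤ}`
is a finite index subgroup of `SL₂(ℤ)`. -/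
theorem stmt15 (α β : ℚ) (m : ℕ) (hm : 1 ≤ m) :
    ∃ H : Subgroup (Matrix.SpecialLinearGroup (Fin 2) ℤ),
      (∀ γ : Matrix.SpecialLinearGroup (Fin 2) ℤ,
        γ ∈ H ↔
          ((ent γ 0 0 - 1) * α + ent γ 1 0 * β ∈ Set.range ((↑) : ℤ → ℚ)
          ∧ ent γ 0 1 * α + (ent γ 1 1 - 1) * β ∈ Set.range ((↑) : ℤ → ℚ)
          ∧ (m : ℚ) * (ent γ 1 0 * β ^ 2 - ent γ 0 1 * α ^ 2
              + (ent γ 1 1 - ent γ 0 0) * α * β) ∈ Set.range ((↑) : ℤ → ℚ)))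
      ∧ H.FiniteIndex := by
  obtain ⟨p, q, δ, hpq, rfl, rfl⟩ := exists_repr α β
  obtain ⟨N, hNdef⟩ : ∃ N : ℤ, N = δ.den := ⟨_, rfl⟩
  obtain ⟨g, hgdef⟩ : ∃ g : ℤ, g = δ.num := ⟨_, rfl⟩
  have hN : N ≠ 0 := by rw [hNdef]; exact_mod_cast δ.den_nz
  have hco : IsCoprime N g := by
    rw [hNdef, hgdef, Int.isCoprime_iff_gcd_eq_one, Int.gcd_comm]
    exact δ.reduced
  have hδ : δ = (g : ℚ) / N := by
    rw [hNdef, hgdef]; exact_mod_cast (Rat.num_div_den δ).symm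
  have hdet : ∀ γ : Matrix.SpecialLinearGroup (Fin 2) ℤ,
      γ.1 0 0 * γ.1 1 1 - γ.1 0 1 * γ.1 1 0 = 1 := fun γ => by
    rw [← Matrix.det_fin_two]; exact γ.2
  let H : Subgroup (Matrix.SpecialLinearGroup (Fin 2) ℤ) :=
    { carrier := {γ | Cond p q m N (γ.1 0 0) (γ.1 0 1) (γ.1 1 0) (γ.1 1 1)}
      mul_mem' := by
        intro γ γ' h h'
        have := cond_mul _ _ _ _ _ _ _ _ _ _ _ _ hN hpq (hdet γ) (hdet γ') h h'
        simpa [Matrix.mul_apply, Fin.sum_univ_two] using this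
      one_mem' := by simp [Cond]
      inv_mem' := by
        intro γ h
        have := cond_inv _ _ _ _ _ _ _ _ (hdet γ) h
        simpa [Matrix.SpecialLinearGroup.coe_inv, Matrix.adjugate_fin_two] using this }
  refine ⟨H, ?_, ?_⟩
  · intro γ
    change Cond p q m N (γ.1 0 0) (γ.1 0 1) (γ.1 1 0) (γ.1 1 1) ↔ _
    unfold Cond ent
    rw [← range_iff g N _ hN hco, ← range_iff g N _ hN hco,
      ← range_iff (g ^ 2) (N ^ 2) _ (pow_ne_zero 2 hN) (hco.pow), hδ]
    push_cast
    refine and_congr (iff_of_eq ?_) (and_congr (iff_of_eq ?_) (iff_of_eq ?_))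
    · congr 1; ring
    · congr 1; ring
    · congr 1; ring
  · haveI : NeZero (δ.den ^ 2) := ⟨pow_ne_zero 2 δ.den_nz⟩
    have hle : CongruenceSubgroup.Gamma (δ.den ^ 2) ≤ H := by
      intro γ hγ
      rw [CongruenceSubgroup.Gamma_mem] at hγ
      obtain ⟨h1, h2, h3, h4⟩ := hγ
      have conv : ∀ n : ℤ, ((n : ℤ) : ZMod (δ.den ^ 2)) = 0 → N ^ 2 ∣ n := by
        intro n hn
        rw [ZMod.intCast_zmod_eq_zero_iff_dvd] at hn
        rw [hNdef]; exact_mod_cast hn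
      obtain ⟨x, hx⟩ := conv (γ.1 0 0 - 1) (by push_cast; exact sub_eq_zero.mpr h1)
      obtain ⟨y, hy⟩ := conv (γ.1 0 1) h2
      obtain ⟨z, hz⟩ := conv (γ.1 1 0) h3
      obtain ⟨t, ht⟩ := conv (γ.1 1 1 - 1) (by push_cast; exact sub_eq_zero.mpr h4)
      refine ⟨⟨N * (p * x + q * z), ?_⟩, ⟨N * (p * y + q * t), ?_⟩,
        ⟨m * (z * q ^ 2 - y * p ^ 2 + (t - x) * p * q), ?_⟩⟩
      · linear_combination p * hx + q * hz
      · linear_combination p * hy + q * ht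
      · linear_combination m * (q ^ 2 * hz - p ^ 2 * hy + p * q * (ht - hx))
    exact Subgroup.finiteIndex_of_le hle
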